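/- arXiv:0904.4382 — 2 statements merged into one kernel-verified Lean document; each statement's English description precedes it below -/
import Mathlib

section
/- For any permutation π ∈ S_k and any Young diagram λ with n = |λ| boxes, the normalized character of the irreducible representation ρ^λ satisfies the Stanley–Féray formula: Σ_π^λ = Σ_{σ₁,σ₂ ∈ S_k, σ₁σ₂ = π} (−1)^{σ₁} · N^λ(σ₁, σ₂), where (−1)^{σ₁} denotes the sign of the permutation σ₁ and the sum runs over all factorizations of π into two permutations in S_k. -/
open scoped BigOperators

namespace AsympRep

/-- A fixed filling: the canonical bijection between `Fin μ.card` and the cells of `μ`. -/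
noncomputable def fill (μ : YoungDiagram) : Fin μ.card ≃ {c // c ∈ μ.cells} :=
  (Fintype.equivFinOfCardEq (Fintype.card_coe _)).symm

/-- Row coordinate of the box occupied by `x` in the canonical filling. -/
noncomputable def rowOf (μ : YoungDiagram) (x : Fin μ.card) : ℕ := (fill μ x).1.1

/-- Column coordinate of the box occupied by `x` in the canonical filling. -/
noncomputable def colOf (μ : YoungDiagram) (x : Fin μ.card) : ℕ := (fill μ x).1.2

/-- The Young symmetrizer `c_μ = a_μ * b_μ` in the group algebra `ℚ[S_n]`, `n = |μ|`,
where `a_μ` is the sum of the row-preserving permutations and `b_μ` is the signed sum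
of the column-preserving permutations (for the canonical filling of `μ`). -/
noncomputable def youngSymmetrizer (μ : YoungDiagram) :
    MonoidAlgebra ℚ (Equiv.Perm (Fin μ.card)) :=
  (∑ g : Equiv.Perm (Fin μ.card),
      if ∀ x, rowOf μ (g x) = rowOf μ x then MonoidAlgebra.single g (1 : ℚ) else 0) *
  (∑ g : Equiv.Perm (Fin μ.card),
      if ∀ x, colOf μ (g x) = colOf μ x
      then MonoidAlgebra.single g ((Equiv.Perm.sign g : ℤ) : ℚ) else 0)

/-- The Specht module: the left ideal `ℚ[S_n]·c_μ`, realizing the irreducible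
representation `ρ^μ` of `S_n` (by left multiplication). -/
noncomputable def spechtModule (μ : YoungDiagram) :
    Submodule ℚ (MonoidAlgebra ℚ (Equiv.Perm (Fin μ.card))) :=
  LinearMap.range (LinearMap.mulRight ℚ (youngSymmetrizer μ))

theorem spechtModule_invariant (μ : YoungDiagram) (π : Equiv.Perm (Fin μ.card)) :
    ∀ x ∈ spechtModule μ,
      (LinearMap.mulLeft ℚ (MonoidAlgebra.single π (1 : ℚ))) x ∈ spechtModule μ := by
  rintro x ⟨y, rfl⟩
  exact ⟨MonoidAlgebra.single π (1 : ℚ) * y, by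
    simp only [LinearMap.mulRight_apply, LinearMap.mulLeft_apply, mul_assoc]⟩

/-- The irreducible character `χ^μ(π) = Tr ρ^μ(π)` of the symmetric group `S_n`,
`n = |μ|`, computed as the trace of left multiplication by `π` on the Specht module. -/
noncomputable def irrChar (μ : YoungDiagram) (π : Equiv.Perm (Fin μ.card)) : ℚ :=
  LinearMap.trace ℚ (spechtModule μ)
    ((LinearMap.mulLeft ℚ (MonoidAlgebra.single π (1 : ℚ))).restrict
      (spechtModule_invariant μ π))

/-- The normalized character
`Σ_π^μ = n(n-1)⋯(n-k+1) · Tr ρ^μ(π) / Tr ρ^μ(e)` for `π ∈ S_k`, where `π` is regarded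
as a permutation of `{1,…,n}` acting as the identity on `{k+1,…,n}`; it is `0` if `k > n`. -/
noncomputable def normChar {k : ℕ} (μ : YoungDiagram) (π : Equiv.Perm (Fin k)) : ℚ :=
  if h : k ≤ μ.card then
    (μ.card.descFactorial k : ℚ)
      * irrChar μ (π.viaEmbedding (Fin.castLEEmb h)) / irrChar μ 1
  else 0

/-- `Σ_m^μ`: the normalized character on the `m`-cycle `(1,2,…,m) ∈ S_m`. -/
noncomputable def SigmaCycle (μ : YoungDiagram) (m : ℕ) : ℚ := normChar μ (finRotate m)

/-- The dilation `sμ` of a Young diagram: every box is replaced by an `s × s` grid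
of boxes. -/
def dilate (μ : YoungDiagram) (s : ℕ) : YoungDiagram where
  cells := (Finset.range (s * μ.colLen 0) ×ˢ Finset.range (s * μ.rowLen 0)).filter
      (fun c => (c.1 / s, c.2 / s) ∈ μ.cells)
  isLowerSet := by
    intro a b hba h
    simp only [Finset.coe_filter, Set.mem_setOf_eq, Finset.mem_product,
      Finset.mem_range] at h ⊢
    exact ⟨⟨lt_of_le_of_lt hba.1 h.1.1, lt_of_le_of_lt hba.2 h.1.2⟩,
      μ.isLowerSet (Prod.mk_le_mk.mpr
        ⟨Nat.div_le_div_right hba.1, Nat.div_le_div_right hba.2⟩) h.2⟩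

open scoped Classical in
/-- The `k`-th free cumulant `R_k^μ`: the coefficient of `s^k` in the polynomial
`s ↦ Σ_{k-1}^{sμ}`. -/
noncomputable def freeCumulant (μ : YoungDiagram) (k : ℕ) : ℚ :=
  if h : ∃ p : Polynomial ℚ, ∀ s : ℕ, 0 < s →
      SigmaCycle (dilate μ s) (k - 1) = Polynomial.eval (s : ℚ) p
  then h.choose.coeff k else 0

/-- `N^μ(σ₁,σ₂)`: the number of colorings of the cycles of `σ₁` (by column numbers)
and of the cycles of `σ₂` (by row numbers) compatible with `μ`.  A coloring of the
cycles is encoded as a pair of functions on points constant on the respective cycles;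
compatibility means that for every point `a` the box in column `h₁(a)` and row `h₂(a)`
belongs to `μ` (two cycles intersect precisely when they share a point). -/
noncomputable def Ncolorings {k : ℕ} (μ : YoungDiagram) (σ₁ σ₂ : Equiv.Perm (Fin k)) : ℕ :=
  Set.ncard {h : (Fin k → ℕ) × (Fin k → ℕ) |
    (∀ a, h.1 (σ₁ a) = h.1 a) ∧ (∀ a, h.2 (σ₂ a) = h.2 a) ∧
    ∀ a, (h.2 a, h.1 a) ∈ μ.cells }

/-- `|C(σ)|`: the number of cycles of a permutation (fixed points count as cycles),
i.e. the number of orbits. -/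
noncomputable def numCycles {k : ℕ} (σ : Equiv.Perm (Fin k)) : ℕ :=
  Set.ncard {s : Set (Fin k) | ∃ a, s = {b | σ.SameCycle a b}}

/-- The region of the plane occupied by the Young diagram `μ` drawn in the French
convention (row `i` of the diagram, `0`-indexed, occupies `[0, μ_i] × [i, i+1]`). -/
def frenchRegion (μ : YoungDiagram) : Set (ℝ × ℝ) :=
  {p | 0 ≤ p.1 ∧ 0 ≤ p.2 ∧ p.1 ≤ (μ.rowLen ⌊p.2⌋.toNat : ℝ)}

/-- The parameter `S_i^μ = (i-1) ∬_{(x,y)∈μ} (x-y)^{i-2} dx dy` (French convention). -/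
noncomputable def Sparam (μ : YoungDiagram) (i : ℕ) : ℝ :=
  ((i : ℝ) - 1) * ∫ p in frenchRegion μ, (p.1 - p.2) ^ (i - 2)

/-- The profile `ω : ℝ → ℝ` of a Young diagram: the boundary of the diagram drawn in
the Russian convention, i.e. the image of the French region under the rotation by `π/4`
composed with the dilation by `√2`, `(x, y) ↦ (x - y, x + y)`.  `ω(u)` is the largest
`v` with `(u,v)` in the rotated region, and `ω(u) = |u|` away from the diagram. -/
noncomputable def profile (μ : YoungDiagram) (u : ℝ) : ℝ :=
  max |u| (sSup {v : ℝ | ((u + v) / 2, (v - u) / 2) ∈ frenchRegion μ})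

section YoungSymmetrizer

open Equiv Finset

theorem perm_apply_inv_self {α : Type*} (p : Perm α) (x : α) : p (p⁻¹ x) = x :=
  Equiv.apply_symm_apply p x

theorem perm_inv_apply_self {α : Type*} (p : Perm α) (x : α) : p⁻¹ (p x) = x :=
  Equiv.symm_apply_apply p x

variable (μ : YoungDiagram)

theorem coeff_youngSymmetrizer (g : Perm (Fin μ.card)) :
    (youngSymmetrizer μ).coeff g = ∑ q : Perm (Fin μ.card),
      if (∀ x, colOf μ (q x) = colOf μ x) ∧ (∀ x, rowOf μ ((g * q⁻¹) x) = rowOf μ x)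
      then ((Perm.sign q : ℤ) : ℚ) else 0 := by
  have hrow : ∀ g : Perm (Fin μ.card),
      (∑ p : Perm (Fin μ.card), if ∀ x, rowOf μ (p x) = rowOf μ x
        then MonoidAlgebra.single p (1 : ℚ) else 0).coeff g =
      if ∀ x, rowOf μ (g x) = rowOf μ x then 1 else 0 := by
    intro g
    rw [MonoidAlgebra.coeff_sum, Finsupp.finsetSum_apply, Finset.sum_eq_single g]
    · split_ifs <;> simp
    · intro b _ hb
      split_ifs <;> simp [hb]
    · simp
  rw [youngSymmetrizer, Finset.mul_sum, MonoidAlgebra.coeff_sum, Finsupp.finsetSum_apply]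
  refine Finset.sum_congr rfl fun q _ => ?_
  rw [ite_and]
  split_ifs with h1 h2
  · rw [MonoidAlgebra.coeff_mul_single_apply, hrow, if_pos h2, one_mul]
  · rw [MonoidAlgebra.coeff_mul_single_apply, hrow, if_neg h2, zero_mul]
  · simp

theorem coeff_youngSymmetrizer_row_mul {p : Perm (Fin μ.card)}
    (hp : ∀ x, rowOf μ (p x) = rowOf μ x) (g : Perm (Fin μ.card)) :
    (youngSymmetrizer μ).coeff (p * g) = (youngSymmetrizer μ).coeff g := by
  simp only [coeff_youngSymmetrizer]
  exact Finset.sum_congr rfl fun q _ => if_congr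
    (and_congr Iff.rfl (by simp only [mul_assoc, Perm.mul_apply, hp])) rfl rfl

theorem coeff_youngSymmetrizer_mul_col {q : Perm (Fin μ.card)}
    (hq : ∀ x, colOf μ (q x) = colOf μ x) (g : Perm (Fin μ.card)) :
    (youngSymmetrizer μ).coeff (g * q) =
      ((Perm.sign q : ℤ) : ℚ) * (youngSymmetrizer μ).coeff g := by
  simp only [coeff_youngSymmetrizer]
  rw [← Equiv.sum_comp (Equiv.mulRight q), Finset.mul_sum]
  refine Finset.sum_congr rfl fun r _ => ?_
  have h1 : (∀ x, colOf μ ((r * q) x) = colOf μ x) ↔ ∀ x, colOf μ (r x) = colOf μ x := by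
    simp only [Perm.mul_apply]
    constructor
    · intro h x
      have h' := (h (q⁻¹ x)).trans (hq (q⁻¹ x)).symm
      rwa [perm_apply_inv_self] at h'
    · intro h x
      rw [h, hq]
  have h2 : g * q * (r * q)⁻¹ = g * r⁻¹ := by group
  rw [Equiv.coe_mulRight, mul_ite, mul_zero, h2, Perm.sign_mul]
  refine if_congr (and_congr h1 Iff.rfl) ?_ rfl
  push_cast
  exact mul_comm _ _

theorem coeff_youngSymmetrizer_one : (youngSymmetrizer μ).coeff 1 = 1 := by
  rw [coeff_youngSymmetrizer, Finset.sum_eq_single 1]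
  · simp
  · intro q _ hq
    rw [if_neg]
    rintro ⟨hc, hr⟩
    refine hq (Equiv.ext fun x => ?_)
    have hr' := hr (q x)
    rw [one_mul, perm_inv_apply_self] at hr'
    exact (fill μ).injective (Subtype.ext (Prod.ext (hr'.symm : rowOf μ (q x) = rowOf μ x) (hc x)))
  · simp

/-- A map that keeps the rows of the boxes and permutes their columns, without
collisions, stays inside the diagram. -/
theorem row_col_mem_cells {g : Perm (Fin μ.card)}
    (hg : Function.Injective fun i => (rowOf μ i, colOf μ (g i))) (i : Fin μ.card) :
    (rowOf μ i, colOf μ (g i)) ∈ μ.cells := by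
  by_contra hi
  set φ : Fin μ.card → ℕ × ℕ := fun i => (rowOf μ i, colOf μ (g i)) with hφ
  let w : ℕ × ℕ → ℤ := fun c => 2 * ((μ.rowLen c.1 : ℤ) - c.2) - 1
  have hpos : ∀ c ∈ μ.cells, 0 < w c := by
    intro c hc
    have := YoungDiagram.mem_iff_lt_rowLen.1 ((YoungDiagram.mem_cells (c := (c.1, c.2))).1 hc)
    simp only [w]
    omega
  have hneg : ∀ c ∉ μ.cells, w c < 0 := by
    intro c hc
    have := mt (fun h => (YoungDiagram.mem_cells (c := (c.1, c.2))).2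
      (YoungDiagram.mem_iff_lt_rowLen.2 h)) hc
    simp only [w]
    omega
  have hsum : ∑ i, w (φ i) = ∑ c ∈ μ.cells, w c := by
    have h1 : ∑ i, w (φ i) = ∑ i, w (rowOf μ i, colOf μ i) := by
      simp only [w, hφ, Finset.sum_sub_distrib, ← Finset.mul_sum]
      rw [Equiv.sum_comp g fun i => (colOf μ i : ℤ)]
    rw [h1, ← Finset.sum_coe_sort μ.cells, ← (fill μ).sum_comp]
    rfl
  have hlt : ∑ c ∈ univ.image φ, w c < ∑ c ∈ (univ.image φ).filter (· ∈ μ.cells), w c := by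
    rw [Finset.sum_filter]
    refine Finset.sum_lt_sum (fun c _ => ?_)
      ⟨φ i, Finset.mem_image_of_mem _ (mem_univ _), ?_⟩
    · split_ifs with h
      · exact le_rfl
      · exact (hneg c h).le
    · rw [if_neg hi]
      exact hneg _ hi
  have hle : ∑ c ∈ (univ.image φ).filter (· ∈ μ.cells), w c ≤ ∑ c ∈ μ.cells, w c :=
    Finset.sum_le_sum_of_subset_of_nonneg (fun c hc => (Finset.mem_filter.1 hc).2)
      fun c hc _ => (hpos c hc).le
  rw [Finset.sum_image fun a _ b _ h => hg h, hsum] at hlt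
  exact absurd hle (not_le.2 hlt)

theorem exists_row_col_factorization {g : Perm (Fin μ.card)}
    (hg : Function.Injective fun i => (rowOf μ i, colOf μ (g⁻¹ i))) :
    ∃ p q : Perm (Fin μ.card), (∀ x, rowOf μ (p x) = rowOf μ x) ∧
      (∀ x, colOf μ (q x) = colOf μ x) ∧ g = p * q := by
  let e : Fin μ.card → Fin μ.card := fun i => (fill μ).symm ⟨_, row_col_mem_cells μ hg i⟩
  have he : ∀ i, (fill μ (e i)).1 = (rowOf μ i, colOf μ (g⁻¹ i)) := by
    intro i
    simp [e]
  have hinj : Function.Injective e := fun i j hij => hg (by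
    have := congrArg (fun x => (fill μ x).1) hij
    simpa only [he] using this)
  let p : Perm (Fin μ.card) := Equiv.ofBijective e (Finite.injective_iff_bijective.1 hinj)
  have hp : ∀ i, p i = e i := fun i => rfl
  refine ⟨p⁻¹, p * g, fun x => ?_, fun x => ?_, by group⟩
  · have := congrArg Prod.fst (he (p⁻¹ x))
    rw [← hp, perm_apply_inv_self] at this
    exact this.symm
  · have := congrArg Prod.snd (he (g x))
    rw [perm_inv_apply_self] at this
    exact this

/-- An element of the group algebra that transforms like the Young symmetrizer is a multiple
of it. -/
theorem eq_smul_youngSymmetrizer {x : MonoidAlgebra ℚ (Perm (Fin μ.card))}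
    (hrow : ∀ p : Perm (Fin μ.card), (∀ i, rowOf μ (p i) = rowOf μ i) →
      ∀ g, x.coeff (p * g) = x.coeff g)
    (hcol : ∀ q : Perm (Fin μ.card), (∀ i, colOf μ (q i) = colOf μ i) →
      ∀ g, x.coeff (g * q) = ((Perm.sign q : ℤ) : ℚ) * x.coeff g) :
    x = x.coeff 1 • youngSymmetrizer μ := by
  have key : ∀ y : MonoidAlgebra ℚ (Perm (Fin μ.card)),
      (∀ p : Perm (Fin μ.card), (∀ i, rowOf μ (p i) = rowOf μ i) →
        ∀ g, y.coeff (p * g) = y.coeff g) →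
      (∀ q : Perm (Fin μ.card), (∀ i, colOf μ (q i) = colOf μ i) →
        ∀ g, y.coeff (g * q) = ((Perm.sign q : ℤ) : ℚ) * y.coeff g) →
      ∀ g, ¬ Function.Injective (fun i => (rowOf μ i, colOf μ (g⁻¹ i))) → y.coeff g = 0 := by
    intro y hr hc g hg
    obtain ⟨i, j, hij, hne⟩ := Function.not_injective_iff.1 hg
    simp only [Prod.mk.injEq] at hij
    have h1 := hr (swap i j) (fun x => by
      rw [Equiv.swap_apply_def]
      split_ifs with h1 h2
      · rw [h1, hij.1]
      · rw [h2, hij.1]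
      · rfl) g
    have h2 := hc (swap (g⁻¹ i) (g⁻¹ j)) (fun x => by
      rw [Equiv.swap_apply_def]
      split_ifs with h1 h2
      · rw [h1, hij.2]
      · rw [h2, hij.2]
      · rfl) g
    have h3 : g * swap (g⁻¹ i) (g⁻¹ j) = swap i j * g := by
      rw [Equiv.mul_swap_eq_swap_mul]
      simp
    have hne' : g⁻¹ i ≠ g⁻¹ j := fun h => hne (g⁻¹.injective h)
    rw [h3, h1, Perm.sign_swap hne'] at h2
    push_cast at h2
    linarith
  ext g
  rw [MonoidAlgebra.coeff_smul_apply, smul_eq_mul]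
  by_cases hg : Function.Injective (fun i => (rowOf μ i, colOf μ (g⁻¹ i)))
  · obtain ⟨p, q, hp, hq, rfl⟩ := exists_row_col_factorization μ hg
    rw [hrow p hp, coeff_youngSymmetrizer_row_mul μ hp, ← one_mul q, hcol q hq,
      coeff_youngSymmetrizer_mul_col μ hq, coeff_youngSymmetrizer_one]
    ring
  · rw [key x hrow hcol g hg, key _ (fun p hp g => coeff_youngSymmetrizer_row_mul μ hp g)
      (fun q hq g => coeff_youngSymmetrizer_mul_col μ hq g) g hg, mul_zero]

theorem youngSymmetrizer_mul_mul (y : MonoidAlgebra ℚ (Perm (Fin μ.card))) :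
    youngSymmetrizer μ * y * youngSymmetrizer μ =
      (youngSymmetrizer μ * y * youngSymmetrizer μ).coeff 1 • youngSymmetrizer μ := by
  apply eq_smul_youngSymmetrizer
  · intro p hp g
    have h : MonoidAlgebra.single p (1 : ℚ) * youngSymmetrizer μ = youngSymmetrizer μ := by
      ext g
      rw [MonoidAlgebra.coeff_single_mul_apply, one_mul, ← coeff_youngSymmetrizer_row_mul μ hp,
        mul_inv_cancel_left]
    have h' : youngSymmetrizer μ * y * youngSymmetrizer μ =
        MonoidAlgebra.single p (1 : ℚ) * (youngSymmetrizer μ * y * youngSymmetrizer μ) := by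
      rw [← mul_assoc, ← mul_assoc, h]
    conv_lhs => rw [h']
    simp
  · intro q hq g
    have h : youngSymmetrizer μ * MonoidAlgebra.single q⁻¹ (1 : ℚ) =
        ((Perm.sign q : ℤ) : ℚ) • youngSymmetrizer μ := by
      ext g
      simp [coeff_youngSymmetrizer_mul_col μ hq]
    rw [← smul_eq_mul (α := ℚ), ← MonoidAlgebra.coeff_smul_apply, ← mul_smul_comm, ← h, ← mul_assoc]
    simp

theorem trace_mulLeft_comp_mulRight {G : Type*} [Group G] [Fintype G] (g : G)
    (c : MonoidAlgebra ℚ G) :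
    LinearMap.trace ℚ (MonoidAlgebra ℚ G)
      (LinearMap.mulLeft ℚ (MonoidAlgebra.single g (1 : ℚ)) ∘ₗ LinearMap.mulRight ℚ c) =
      ∑ h : G, c.coeff (h⁻¹ * g⁻¹ * h) := by
  classical
  rw [LinearMap.trace_eq_matrix_trace ℚ (MonoidAlgebra.basis G ℚ), Matrix.trace]
  refine Finset.sum_congr rfl fun h _ => ?_
  rw [Matrix.diag_apply, LinearMap.toMatrix_apply, MonoidAlgebra.basis_apply]
  change (MonoidAlgebra.single g (1 : ℚ) * (MonoidAlgebra.single h (1 : ℚ) * c)).coeff h = _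
  simp [mul_assoc]

theorem irrChar_mul_coeff (g : Perm (Fin μ.card)) :
    (youngSymmetrizer μ * 1 * youngSymmetrizer μ).coeff 1 * irrChar μ g =
      ∑ h : Perm (Fin μ.card), (youngSymmetrizer μ).coeff (h⁻¹ * g⁻¹ * h) := by
  rw [irrChar, ← smul_eq_mul, ← map_smul, ← trace_mulLeft_comp_mulRight]
  have hmem : ∀ x, (LinearMap.mulLeft ℚ (MonoidAlgebra.single g (1 : ℚ)) ∘ₗ
      LinearMap.mulRight ℚ (youngSymmetrizer μ)) x ∈ spechtModule μ := fun x =>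
    spechtModule_invariant μ g _ ⟨x, rfl⟩
  rw [← LinearMap.trace_restrict_eq_of_forall_mem (spechtModule μ) _ hmem]
  congr 1
  ext1 ⟨x, hx⟩
  apply Subtype.ext
  obtain ⟨y, rfl⟩ := hx
  have h := youngSymmetrizer_mul_mul μ 1
  simp only [mul_one] at h ⊢
  simp only [LinearMap.smul_apply, LinearMap.restrict_apply, LinearMap.comp_apply,
    LinearMap.mulLeft_apply, LinearMap.mulRight_apply, Submodule.coe_smul]
  rw [mul_assoc y, h, mul_smul_comm, mul_smul_comm, ← h]

theorem irrChar_div_irrChar_one (g : Perm (Fin μ.card)) :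
    irrChar μ g / irrChar μ 1 =
      (∑ h : Perm (Fin μ.card), (youngSymmetrizer μ).coeff (h⁻¹ * g⁻¹ * h)) /
        (μ.card.factorial : ℚ) := by
  have h1 := irrChar_mul_coeff μ 1
  simp only [inv_one, mul_one, inv_mul_cancel, coeff_youngSymmetrizer_one, Finset.sum_const,
    Finset.card_univ, Fintype.card_perm, Fintype.card_fin, nsmul_eq_mul] at h1
  have hg := irrChar_mul_coeff μ g
  rw [mul_one] at hg
  have hn : (μ.card.factorial : ℚ) ≠ 0 := by positivity
  have hγ := left_ne_zero_of_mul (h1.trans_ne hn)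
  rw [← hg, ← h1, mul_div_mul_left _ _ hγ]

end YoungSymmetrizer

section Factorizations

open Equiv Finset

/-- The signed number of factorizations `π = σ₁ σ₂` for which the placement `f` of points in
boxes has columns constant on the cycles of `σ₁` and rows constant on the cycles of `σ₂`. -/
noncomputable def signedFactorizations {α : Type*} [Fintype α] [DecidableEq α]
    (f : α → ℕ × ℕ) (π : Perm α) : ℚ :=
  ∑ σ : Perm α, if (∀ a, (f (σ a)).2 = (f a).2) ∧ (∀ a, (f ((σ⁻¹ * π) a)).1 = (f a).1)
    then ((Perm.sign σ : ℤ) : ℚ) else 0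

theorem signedFactorizations_eq_zero {α : Type*} [Fintype α] [DecidableEq α]
    {f : α → ℕ × ℕ} (hf : ¬ Function.Injective f) (π : Perm α) :
    signedFactorizations f π = 0 := by
  obtain ⟨i, j, hij, hne⟩ := Function.not_injective_iff.1 hf
  have hs : ∀ a, f (swap i j a) = f a := by
    intro a
    rw [Equiv.swap_apply_def]
    split_ifs with h1 h2
    · rw [h1, hij]
    · rw [h2, hij]
    · rfl
  have h : signedFactorizations f π = -signedFactorizations f π := by
    conv_lhs => rw [signedFactorizations, ← Equiv.sum_comp (Equiv.mulRight (swap i j))]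
    rw [signedFactorizations, ← Finset.sum_neg_distrib]
    refine Finset.sum_congr rfl fun σ _ => ?_
    have h1 : (∀ a, (f ((σ * swap i j) a)).2 = (f a).2) ↔ ∀ a, (f (σ a)).2 = (f a).2 := by
      rw [← (swap i j).forall_congr_right (q := fun a => (f (σ a)).2 = (f a).2)]
      simp only [Perm.mul_apply, hs]
    have h2 : (∀ a, (f (((σ * swap i j)⁻¹ * π) a)).1 = (f a).1) ↔
        ∀ a, (f ((σ⁻¹ * π) a)).1 = (f a).1 := by
      simp only [mul_inv_rev, swap_inv, mul_assoc, Perm.mul_apply, hs]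
    rw [Equiv.coe_mulRight, Perm.sign_mul, Perm.sign_swap hne, apply_ite Neg.neg, neg_zero]
    refine if_congr (and_congr h1 h2) ?_ rfl
    push_cast
    ring
  linarith

/-- A permutation fixing every point outside the range of an embedding comes from a
permutation of the source. -/
theorem exists_viaEmbedding_eq {α β : Type*} [Finite α] (ι : α ↪ β) {σ : Perm β}
    (hσ : ∀ b ∉ Set.range ι, σ b = b) : ∃ τ : Perm α, τ.viaEmbedding ι = σ := by
  have hmem : ∀ a, ∃ a', ι a' = σ (ι a) := by
    intro a
    by_contra h
    exact h ⟨a, (σ.injective (hσ _ h)).symm⟩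
  choose τ hτ using hmem
  have hinj : Function.Injective τ := fun a b hab =>
    ι.injective (σ.injective (by rw [← hτ, ← hτ, hab]))
  refine ⟨Equiv.ofBijective τ (Finite.injective_iff_bijective.1 hinj), Equiv.ext fun b => ?_⟩
  by_cases hb : b ∈ Set.range ι
  · obtain ⟨a, rfl⟩ := hb
    rw [Perm.viaEmbedding_apply, Equiv.ofBijective_apply, hτ]
  · rw [Perm.viaEmbedding_apply_of_notMem _ _ _ hb, hσ b hb]

theorem forall_viaEmbedding_apply_eq_iff {α β γ : Type*} (ι : α ↪ β) (τ : Perm α) (f : β → γ) :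
    (∀ b, f (τ.viaEmbedding ι b) = f b) ↔ ∀ a, f (ι (τ a)) = f (ι a) := by
  constructor
  · intro h a
    rw [← Perm.viaEmbedding_apply, h]
  · intro h b
    by_cases hb : b ∈ Set.range ι
    · obtain ⟨a, rfl⟩ := hb
      rw [Perm.viaEmbedding_apply, h]
    · rw [Perm.viaEmbedding_apply_of_notMem _ _ _ hb]

theorem signedFactorizations_viaEmbedding {α β : Type*} [Fintype α] [DecidableEq α]
    [Fintype β] [DecidableEq β] (ι : α ↪ β) {f : β → ℕ × ℕ} (hf : Function.Injective f)
    (π : Perm α) :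
    signedFactorizations f (π.viaEmbedding ι) = signedFactorizations (f ∘ ι) π := by
  rw [signedFactorizations, signedFactorizations]
  symm
  refine Finset.sum_of_injOn (Perm.viaEmbeddingHom ι)
    (Perm.viaEmbeddingHom_injective ι).injOn (fun _ _ => mem_coe.2 (mem_univ _)) ?_ ?_
  · rintro σ - hσ
    refine if_neg ?_
    rintro ⟨hc, hr⟩
    obtain ⟨τ, rfl⟩ := exists_viaEmbedding_eq ι (σ := σ) fun b hb => by
      have h1 := hr b
      rw [Perm.mul_apply, Perm.viaEmbedding_apply_of_notMem _ _ _ hb] at h1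
      have h2 := hc (σ⁻¹ b)
      rw [perm_apply_inv_self] at h2
      rw [← Perm.inv_eq_iff_eq.1 (hf (Prod.ext h1 h2.symm))]
    exact hσ ⟨τ, mem_coe.2 (mem_univ _), rfl⟩
  · intro σ _
    have hmul : (Perm.viaEmbeddingHom ι σ)⁻¹ * π.viaEmbedding ι =
        (σ⁻¹ * π).viaEmbedding ι := by
      rw [← Perm.viaEmbeddingHom_apply, ← Perm.viaEmbeddingHom_apply, map_mul, map_inv]
    have hsign : Perm.sign (Perm.viaEmbeddingHom ι σ) = Perm.sign σ := by
      rw [Perm.viaEmbeddingHom_apply, Perm.viaEmbedding, Perm.sign_extendDomain]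
    rw [hmul, hsign]
    exact if_congr (and_congr
      (forall_viaEmbedding_apply_eq_iff ι σ fun b => (f b).2).symm
      (forall_viaEmbedding_apply_eq_iff ι (σ⁻¹ * π) fun b => (f b).1).symm) rfl rfl

theorem sum_equiv_comp_embedding {α β γ : Type*} [Fintype α] [DecidableEq α] [Fintype β]
    [DecidableEq β] [Fintype γ] [DecidableEq γ] (h : Fintype.card β = Fintype.card γ)
    (ι : α ↪ β) (ψ : (α ↪ γ) → ℚ) :
    ∑ e : β ≃ γ, ψ (ι.trans e.toEmbedding) =
      ((Fintype.card β - Fintype.card α).factorial : ℚ) * ∑ f : α ↪ γ, ψ f := by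
  rw [← Finset.sum_fiberwise (s := univ) (g := fun e : β ≃ γ => ι.trans e.toEmbedding),
    Finset.mul_sum]
  refine Finset.sum_congr rfl fun f _ => ?_
  rw [Finset.sum_congr rfl (g := fun _ => ψ f) (fun e he => by rw [(mem_filter.1 he).2]),
    Finset.sum_const, nsmul_eq_mul]
  congr 2
  let e₀ : Set.range ι ≃ Set.range f :=
    (Equiv.ofInjective ι ι.injective).symm.trans (Equiv.ofInjective f f.injective)
  have he₀ : ∀ a, (e₀ ⟨ι a, a, rfl⟩ : γ) = f a := by
    intro a
    have : (Equiv.ofInjective ι ι.injective).symm ⟨ι a, a, rfl⟩ = a :=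
      Equiv.ofInjective_symm_apply ι.injective a
    simp [e₀, this]
  have key : {e : β ≃ γ // ι.trans e.toEmbedding = f} ≃
      {e : β ≃ γ // ∀ x : Set.range ι, e x = e₀ x} := by
    refine Equiv.subtypeEquivRight fun e => ?_
    constructor
    · rintro h ⟨_, a, rfl⟩
      rw [he₀, ← h]
      rfl
    · intro h
      ext a
      rw [← he₀, ← h]
      rfl
  classical
  have hα : Fintype.card ((Set.range ι)ᶜ : Set β) = Fintype.card β - Fintype.card α := by
    rw [Fintype.card_compl_set, Set.card_range_of_injective ι.injective]
  have hγ : Fintype.card ((Set.range f)ᶜ : Set γ) = Fintype.card β - Fintype.card α := by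
    rw [Fintype.card_compl_set, Set.card_range_of_injective f.injective, h]
  rw [← Fintype.card_subtype, Fintype.card_congr (key.trans (Equiv.Set.compl e₀)),
    Fintype.card_equiv (Fintype.equivOfCardEq (hα.trans hγ.symm)), hα]

theorem sum_coeff_youngSymmetrizer_conj (μ : YoungDiagram) (π : Perm (Fin μ.card)) :
    ∑ h : Perm (Fin μ.card), (youngSymmetrizer μ).coeff (h⁻¹ * π⁻¹ * h) =
      ∑ e : Fin μ.card ≃ {c // c ∈ μ.cells}, signedFactorizations (fun i => (e i).1) π := by
  rw [← Equiv.sum_comp ((Equiv.inv _).trans (Equiv.equivCongr (Equiv.refl _) (fill μ)))]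
  refine Finset.sum_congr rfl fun h _ => ?_
  rw [coeff_youngSymmetrizer, signedFactorizations,
    ← Equiv.sum_comp ((Equiv.inv _).trans (MulAut.conj h⁻¹).toEquiv)]
  refine Finset.sum_congr rfl fun s _ => ?_
  have hs : ((Equiv.inv _).trans (MulAut.conj h⁻¹).toEquiv) s = h⁻¹ * s⁻¹ * h := by
    simp
  rw [hs]
  have hsign : Perm.sign (h⁻¹ * s⁻¹ * h) = Perm.sign s := by
    rw [mul_assoc, Perm.sign_mul, mul_comm, ← Perm.sign_mul, mul_inv_cancel_right,
      Perm.sign_inv]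
  rw [hsign]
  have hcol : (∀ x, colOf μ ((h⁻¹ * s⁻¹ * h) x) = colOf μ x) ↔
      ∀ a, colOf μ (h⁻¹ (s a)) = colOf μ (h⁻¹ a) := by
    constructor
    · intro H a
      have := H (h⁻¹ (s a))
      simp only [Perm.mul_apply, perm_apply_inv_self, perm_inv_apply_self] at this
      exact this.symm
    · intro H x
      have := H (s⁻¹ (h x))
      simp only [perm_apply_inv_self, perm_inv_apply_self] at this
      exact this.symm
  have hrow : (∀ x, rowOf μ ((h⁻¹ * π⁻¹ * h * (h⁻¹ * s⁻¹ * h)⁻¹) x) = rowOf μ x) ↔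
      ∀ a, rowOf μ (h⁻¹ ((s⁻¹ * π) a)) = rowOf μ (h⁻¹ a) := by
    have hmul : h⁻¹ * π⁻¹ * h * (h⁻¹ * s⁻¹ * h)⁻¹ = h⁻¹ * π⁻¹ * s * h := by group
    rw [hmul]
    constructor
    · intro H a
      have := H (h⁻¹ (s⁻¹ (π a)))
      simp only [Perm.mul_apply, perm_apply_inv_self, perm_inv_apply_self] at this
      exact this.symm
    · intro H x
      have := H (π⁻¹ (s (h x)))
      simp only [Perm.mul_apply, perm_apply_inv_self, perm_inv_apply_self] at this
      exact this.symm
  rw [if_congr (and_congr hcol hrow) rfl rfl]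
  congr

theorem sum_Ncolorings_eq_sum_signedFactorizations {k : ℕ} (μ : YoungDiagram)
    (π : Perm (Fin k)) :
    (∑ σ₁ : Perm (Fin k), ∑ σ₂ : Perm (Fin k),
        if σ₁ * σ₂ = π then
          ((Perm.sign σ₁ : ℤ) : ℚ) * (Ncolorings μ σ₁ σ₂ : ℚ)
        else 0) =
      ∑ f : Fin k → {c // c ∈ μ.cells}, signedFactorizations (fun i => (f i).1) π := by
  have hN : ∀ σ₁ σ₂ : Perm (Fin k), (Ncolorings μ σ₁ σ₂ : ℚ) =
      ∑ f : Fin k → {c // c ∈ μ.cells},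
        if (∀ a, (f (σ₁ a)).1.2 = (f a).1.2) ∧ (∀ a, (f (σ₂ a)).1.1 = (f a).1.1)
        then 1 else 0 := by
    intro σ₁ σ₂
    rw [Finset.sum_boole, ← Fintype.card_subtype, Ncolorings, ← Nat.card_coe_set_eq,
      ← Nat.card_eq_fintype_card]
    congr 1
    refine Nat.card_congr
      { toFun := fun h => ⟨fun a => ⟨_, h.2.2.2 a⟩, h.2.1, h.2.2.1⟩
        invFun := fun f => ⟨(fun a => (f.1 a).1.2, fun a => (f.1 a).1.1), f.2.1, f.2.2,
          fun a => (f.1 a).2⟩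
        left_inv := fun h => rfl
        right_inv := fun f => rfl }
  simp only [signedFactorizations]
  rw [Finset.sum_comm (s := univ (α := Fin k → {c // c ∈ μ.cells}))]
  refine Finset.sum_congr rfl fun σ _ => ?_
  rw [Finset.sum_eq_single (σ⁻¹ * π), if_pos (mul_inv_cancel_left _ _), hN, Finset.mul_sum]
  · simp only [mul_ite, mul_one, mul_zero]
    exact Finset.sum_congr rfl fun _ _ => by congr
  · intro τ _ hτ
    exact if_neg fun h => hτ (by rw [← h, inv_mul_cancel_left])
  · simp

theorem sum_signedFactorizations_eq_sum_embedding {α : Type*} [Fintype α] [DecidableEq α]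
    (μ : YoungDiagram) (π : Perm α) :
    ∑ f : α → {c // c ∈ μ.cells}, signedFactorizations (fun i => (f i).1) π =
      ∑ f : α ↪ {c // c ∈ μ.cells}, signedFactorizations (fun i => (f i).1) π := by
  symm
  refine Finset.sum_of_injOn (fun f => ⇑f) DFunLike.coe_injective.injOn
    (fun _ _ => mem_coe.2 (mem_univ _)) ?_ (fun _ _ => rfl)
  intro f _ hf
  refine signedFactorizations_eq_zero (fun hinj => hf ?_) π
  exact ⟨⟨f, fun a b h => hinj (congrArg Subtype.val h)⟩, mem_coe.2 (mem_univ _), rfl⟩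

end Factorizations

/-- **Stanley–Féray formula.** For any permutation `π ∈ S_k` and any Young diagram `μ`
(with `n = |μ|` boxes), the normalized character of the irreducible representation `ρ^μ`
satisfies `Σ_π^μ = ∑_{σ₁σ₂ = π} (-1)^{σ₁} N^μ(σ₁, σ₂)`, the sum running over all
factorizations of `π` into two permutations of `S_k`. -/
theorem stanley_feray_formula {k : ℕ} (μ : YoungDiagram) (π : Equiv.Perm (Fin k)) :
    normChar μ π =
      ∑ σ₁ : Equiv.Perm (Fin k), ∑ σ₂ : Equiv.Perm (Fin k),
        if σ₁ * σ₂ = π then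
          ((Equiv.Perm.sign σ₁ : ℤ) : ℚ) * (Ncolorings μ σ₁ σ₂ : ℚ)
        else 0 := by
  rw [sum_Ncolorings_eq_sum_signedFactorizations, sum_signedFactorizations_eq_sum_embedding,
    normChar]
  split_ifs with h
  · have hcard : Fintype.card (Fin μ.card) = Fintype.card {c // c ∈ μ.cells} := by
      rw [Fintype.card_fin, Fintype.card_coe]
    have hvia : ∀ e : Fin μ.card ≃ {c // c ∈ μ.cells},
        signedFactorizations (fun i => (e i).1) (π.viaEmbedding (Fin.castLEEmb h)) =
          signedFactorizations (fun i => (((Fin.castLEEmb h).trans e.toEmbedding) i).1) π :=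
      fun e => signedFactorizations_viaEmbedding _
        (Subtype.val_injective.comp e.injective) π
    rw [mul_div_assoc, irrChar_div_irrChar_one, sum_coeff_youngSymmetrizer_conj,
      Finset.sum_congr rfl fun e _ => hvia e,
      sum_equiv_comp_embedding hcard (Fin.castLEEmb h)
        (fun f => signedFactorizations (fun i => (f i).1) π),
      Fintype.card_fin, Fintype.card_fin, ← Nat.factorial_mul_descFactorial h]
    have h1 : ((μ.card - k).factorial : ℚ) ≠ 0 := by positivity
    have h2 : (μ.card.descFactorial k : ℚ) ≠ 0 := by
      exact_mod_cast (Nat.descFactorial_pos.2 h).ne'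
    push_cast
    field_simp
  · have : IsEmpty (Fin k ↪ {c // c ∈ μ.cells}) := by
      refine ⟨fun f => h ?_⟩
      have := Fintype.card_le_of_embedding f
      rwa [Fintype.card_fin, Fintype.card_coe] at this
    rw [Finset.univ_eq_empty, Finset.sum_empty]

end AsympRep
end

section
/- For any permutations σ₁, σ₂ ∈ S_k, any Young diagram λ, and any positive integer s, the number of compatible colorings satisfies the homogeneity relation N^{sλ}(σ₁, σ₂) = s^{|C(σ₁)| + |C(σ₂)|} · N^λ(σ₁, σ₂), where |C(σ₁)| + |C(σ₂)| is the total number of cycles of σ₁ and σ₂. -/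
open scoped BigOperators

namespace AsympRep

theorem mem_dilate_cells {μ : YoungDiagram} {s : ℕ} (hs : 0 < s) {c : ℕ × ℕ} :
    c ∈ (dilate μ s).cells ↔ (c.1 / s, c.2 / s) ∈ μ.cells := by
  simp only [dilate, Finset.mem_filter, Finset.mem_product, Finset.mem_range, and_iff_right_iff_imp]
  intro h
  rw [YoungDiagram.mem_cells] at h
  constructor
  · have h₀ := μ.up_left_mem le_rfl (Nat.zero_le _) h
    rw [YoungDiagram.mem_iff_lt_colLen, Nat.div_lt_iff_lt_mul hs] at h₀
    rwa [mul_comm]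
  · have h₀ := μ.up_left_mem (Nat.zero_le _) le_rfl h
    rw [YoungDiagram.mem_iff_lt_rowLen, Nat.div_lt_iff_lt_mul hs] at h₀
    rwa [mul_comm]

theorem numCycles_eq_card_quotient {k : ℕ} (σ : Equiv.Perm (Fin k)) :
    numCycles σ = Nat.card (Quotient (Equiv.Perm.SameCycle.setoid σ)) := by
  have h : {t : Set (Fin k) | ∃ a, t = {b | σ.SameCycle a b}}
      = (Equiv.Perm.SameCycle.setoid σ).classes := by
    ext t
    refine exists_congr fun a => ?_
    have : {b | σ.SameCycle a b} = {b | Equiv.Perm.SameCycle.setoid σ b a} :=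
      Set.ext fun b => Equiv.Perm.sameCycle_comm
    rw [this]
  rw [numCycles, h, ← Nat.card_coe_set_eq]
  exact Nat.card_congr (Setoid.quotientEquivClasses _).symm

theorem eq_of_sameCycle {α β : Type*} {σ : Equiv.Perm α} {f : α → β}
    (hf : ∀ a, f (σ a) = f a) {a b : α} (h : σ.SameCycle a b) : f a = f b := by
  obtain ⟨i, rfl⟩ := h
  induction i with
  | zero => simp
  | succ i ih => rw [add_comm, zpow_add, zpow_one, Equiv.Perm.mul_apply, hf, ih]
  | pred i ih =>
    rw [ih, ← hf ((σ ^ (-(i : ℤ) - 1)) a), ← Equiv.Perm.mul_apply, ← zpow_one_add]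
    simp

/-- Functions invariant under a permutation are the functions on its set of cycles. -/
def invariantEquiv {α : Type*} (β : Type*) (σ : Equiv.Perm α) :
    {f : α → β // ∀ a, f (σ a) = f a} ≃ (Quotient (Equiv.Perm.SameCycle.setoid σ) → β) where
  toFun f := Quotient.lift f.1 fun _ _ h => eq_of_sameCycle f.2 h
  invFun g := ⟨fun a => g (Quotient.mk _ a), fun _ =>
    congrArg g (Quotient.sound (Equiv.Perm.sameCycle_apply_left.mpr (.refl _ _)))⟩
  left_inv _ := rfl
  right_inv _ := funext fun q => Quotient.inductionOn q fun _ => rfl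

theorem card_invariant {k : ℕ} (σ : Equiv.Perm (Fin k)) (s : ℕ) :
    Nat.card {f : Fin k → Fin s // ∀ a, f (σ a) = f a} = s ^ numCycles σ := by
  rw [Nat.card_congr (invariantEquiv (Fin s) σ), Nat.card_fun, Nat.card_fin,
    numCycles_eq_card_quotient]

/-- The colorings counted by `Ncolorings`. -/
def colorings {k : ℕ} (μ : YoungDiagram) (σ₁ σ₂ : Equiv.Perm (Fin k)) :
    Set ((Fin k → ℕ) × (Fin k → ℕ)) :=
  {h | (∀ a, h.1 (σ₁ a) = h.1 a) ∧ (∀ a, h.2 (σ₂ a) = h.2 a) ∧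
    ∀ a, (h.2 a, h.1 a) ∈ μ.cells}

/-- A coloring compatible with `dilate μ s` splits into its quotient by `s`, compatible with `μ`,
and its remainders modulo `s`, which are arbitrary. -/
def coloringsDilateEquiv {k : ℕ} (σ₁ σ₂ : Equiv.Perm (Fin k)) (μ : YoungDiagram)
    (s : ℕ) (hs : 0 < s) :
    colorings (dilate μ s) σ₁ σ₂ ≃
      ({f : Fin k → Fin s // ∀ a, f (σ₁ a) = f a} × {f : Fin k → Fin s // ∀ a, f (σ₂ a) = f a})
        × colorings μ σ₁ σ₂ where
  toFun h :=
    ((⟨fun a => ⟨h.1.1 a % s, Nat.mod_lt _ hs⟩, fun a => by simp only [h.2.1 a]⟩,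
      ⟨fun a => ⟨h.1.2 a % s, Nat.mod_lt _ hs⟩, fun a => by simp only [h.2.2.1 a]⟩),
      ⟨(fun a => h.1.1 a / s, fun a => h.1.2 a / s), fun a => by simp only [h.2.1 a],
        fun a => by simp only [h.2.2.1 a], fun a => (mem_dilate_cells hs).mp (h.2.2.2 a)⟩)
  invFun p :=
    ⟨(fun a => p.1.1.1 a + s * p.2.1.1 a, fun a => p.1.2.1 a + s * p.2.1.2 a),
      fun a => by simp only [p.1.1.2 a, p.2.2.1 a],
      fun a => by simp only [p.1.2.2 a, p.2.2.2.1 a],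
      fun a => by
        rw [mem_dilate_cells hs]
        simpa [Nat.add_mul_div_left _ _ hs, Nat.div_eq_of_lt] using p.2.2.2.2 a⟩
  left_inv h := Subtype.ext (Prod.ext (funext fun _ => Nat.mod_add_div _ _)
    (funext fun _ => Nat.mod_add_div _ _))
  right_inv p := by
    refine Prod.ext (Prod.ext (Subtype.ext (funext fun a => Fin.ext ?_))
      (Subtype.ext (funext fun a => Fin.ext ?_)))
      (Subtype.ext (Prod.ext (funext fun a => ?_) (funext fun a => ?_)))
    all_goals simp [Nat.add_mul_div_left _ _ hs, Nat.div_eq_of_lt, Nat.mod_eq_of_lt]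

/-- For any `σ₁, σ₂ ∈ S_k`, any Young diagram `μ` and any positive integer `s`,
the number of compatible colorings satisfies
`N^{sμ}(σ₁,σ₂) = s^(|C(σ₁)|+|C(σ₂)|) · N^μ(σ₁,σ₂)`. -/
theorem ncolorings_dilate {k : ℕ} (σ₁ σ₂ : Equiv.Perm (Fin k)) (μ : YoungDiagram)
    (s : ℕ) (hs : 0 < s) :
    Ncolorings (dilate μ s) σ₁ σ₂
      = s ^ (numCycles σ₁ + numCycles σ₂) * Ncolorings μ σ₁ σ₂ := by
  have h := Nat.card_congr (coloringsDilateEquiv σ₁ σ₂ μ s hs)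
  rw [Nat.card_prod, Nat.card_prod, card_invariant, card_invariant, ← pow_add] at h
  exact h

end AsympRep
end
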